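/- arXiv:1801.06754 — 2 statements merged into one kernel-verified Lean document; each statement's English description precedes it below -/
import Mathlib

section
/- If the vertex set of a finite simple graph G can be partitioned into one independent set and t−1 sets each inducing a forest in G, then the sum-color cost satisfies ŝ(G) ≤ ((3t−1)/2)·|V(G)|. -/
open Finset

/-- Auxiliary fuelled recursion for the slow-coloring game value.
`slowAux G n S` computes the value of the slow-coloring game on the
subgraph of `G` induced by the set `S` of (uncolored) vertices, provided
`n ≥ S.card`. -/
noncomputable def slowAux {V : Type*} [DecidableEq V] (G : SimpleGraph V) :
    ℕ → Finset V → ℕ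
  | 0, _ => 0
  | n + 1, S =>
      (S.powerset.filter fun M => M.Nonempty).sup fun M =>
        M.card + sInf {k : ℕ | ∃ X : Finset V, X ⊆ M ∧ X.Nonempty ∧
          (∀ x ∈ X, ∀ y ∈ X, ¬ G.Adj x y) ∧ k = slowAux G n (S \ X)}

/-- The sum-color cost `ŝ(G[S])` of the subgraph of `G` induced by the
vertex set `S`. -/
noncomputable def slowCost {V : Type*} [DecidableEq V] (G : SimpleGraph V)
    (S : Finset V) : ℕ :=
  slowAux G S.card S

namespace SlowColoring

variable {V : Type*} [DecidableEq V] (G : SimpleGraph V)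

/-- No edge of `G` joins `A` to `B`. -/
def Separated (A B : Finset V) : Prop :=
  ∀ a ∈ A, ∀ b ∈ B, ¬ G.Adj a b

/-- `C` has no partition into two nonempty sets without edges between them. -/
def Indecomposable (C : Finset V) : Prop :=
  ∀ D ⊆ C, Separated G D (C \ D) → D = ∅ ∨ D = C

open Classical in
/-- The components of odd order of the subgraph induced by `S`. -/
noncomputable def oddParts (S : Finset V) : Finset (Finset V) :=
  S.powerset.filter fun C => Odd C.card ∧ Separated G C (S \ C) ∧ Indecomposable G C

/-- The number of components of odd order of the subgraph induced by `S`. -/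
noncomputable def oddCount (S : Finset V) : ℕ :=
  (oddParts G S).card

variable {G}

lemma mem_oddParts {S C : Finset V} :
    C ∈ oddParts G S ↔
      C ⊆ S ∧ Odd C.card ∧ Separated G C (S \ C) ∧ Indecomposable G C := by
  simp [oddParts]

omit [DecidableEq V] in
lemma Separated.symm {A B : Finset V} (h : Separated G A B) : Separated G B A :=
  fun b hb a ha hba => h a ha b hb hba.symm

lemma oddParts_union {A B : Finset V} (hd : Disjoint A B) (hs : Separated G A B) :
    oddParts G (A ∪ B) = oddParts G A ∪ oddParts G B := by
  have hd' := Finset.disjoint_left.1 hd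
  ext C
  simp only [Finset.mem_union, mem_oddParts]
  constructor
  · rintro ⟨hC, hodd, hsep, hind⟩
    have hsplit : Separated G (C ∩ A) (C \ (C ∩ A)) := by
      intro a ha b hb
      refine hs a (by grind) b (by grind)
    rcases hind (C ∩ A) Finset.inter_subset_left hsplit with h | h
    · right
      have hCA := Finset.disjoint_left.1 (Finset.disjoint_iff_inter_eq_empty.2 h)
      refine ⟨by grind, hodd, fun a ha b hb => hsep a ha b (by grind), hind⟩
    · left
      refine ⟨by grind, hodd, fun a ha b hb => hsep a ha b (by grind), hind⟩
  · rintro (⟨hC, hodd, hsep, hind⟩ | ⟨hC, hodd, hsep, hind⟩)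
    · refine ⟨by grind, hodd, fun a ha b hb => ?_, hind⟩
      by_cases hb' : b ∈ A
      · exact hsep a ha b (by grind)
      · exact hs a (hC ha) b (by grind)
    · refine ⟨by grind, hodd, fun a ha b hb => ?_, hind⟩
      by_cases hb' : b ∈ B
      · exact hsep a ha b (by grind)
      · exact hs.symm a (hC ha) b (by grind)

lemma oddCount_union {A B : Finset V} (hd : Disjoint A B) (hs : Separated G A B) :
    oddCount G (A ∪ B) = oddCount G A + oddCount G B := by
  rw [oddCount, oddParts_union hd hs, Finset.card_union_of_disjoint]
  · rfl
  · rw [Finset.disjoint_left]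
    intro C hA hB
    rw [mem_oddParts] at hA hB
    obtain ⟨v, hv⟩ := Finset.card_pos.1 hA.2.1.pos
    exact Finset.disjoint_left.1 hd (hA.1 hv) (hB.1 hv)

lemma Indecomposable.oddCount_eq {S : Finset V} (h : Indecomposable G S) :
    oddCount G S = S.card % 2 := by
  have hmem : ∀ C, C ∈ oddParts G S ↔ C = S ∧ Odd S.card := by
    intro C
    rw [mem_oddParts]
    constructor
    · rintro ⟨hC, hodd, hsep, -⟩
      rcases h C hC hsep with rfl | rfl
      · simp at hodd
      · exact ⟨rfl, hodd⟩
    · rintro ⟨rfl, hodd⟩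
      exact ⟨subset_rfl, hodd, by simp [Separated], h⟩
  rcases Nat.even_or_odd S.card with he | ho
  · have : oddParts G S = ∅ := by
      ext C
      simp [hmem, Nat.not_odd_iff_even.2 he]
    rw [oddCount, this, Finset.card_empty, Nat.even_iff.1 he]
  · have : oddParts G S = {S} := by
      ext C
      simp [hmem, ho]
    rw [oddCount, this, Finset.card_singleton, Nat.odd_iff.1 ho]

/-- Induction on components: a property holds for all sets if it holds for indecomposable ones
and is stable under unions of sets with no edges between them. -/
lemma induction_parts {P : Finset V → Prop} (hind : ∀ S, Indecomposable G S → P S)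
    (hunion : ∀ A B, Disjoint A B → Separated G A B → P A → P B → P (A ∪ B)) (S : Finset V) :
    P S := by
  induction S using Finset.strongInduction with
  | H S ih =>
    by_cases h : Indecomposable G S
    · exact hind S h
    · simp only [Indecomposable] at h
      push Not at h
      obtain ⟨D, hD, hsep, hne, hne'⟩ := h
      have hDS : D ⊂ S := hD.ssubset_of_ne hne'
      have hDS' : S \ D ⊂ S := Finset.sdiff_ssubset hD hne
      have := hunion D (S \ D) Finset.disjoint_sdiff hsep (ih D hDS) (ih _ hDS')
      rwa [Finset.union_sdiff_of_subset hD] at this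

lemma oddCount_le_and_mod (S : Finset V) :
    oddCount G S ≤ S.card ∧ oddCount G S % 2 = S.card % 2 := by
  induction S using induction_parts (G := G) with
  | hind S h => rw [h.oddCount_eq]; omega
  | hunion A B hd hs hA hB =>
    rw [oddCount_union hd hs, Finset.card_union_of_disjoint hd]; omega

variable (G) in
/-- Coloring `X ∋ r` when `M ∩ T` is marked in `T` gains at least `v` (doubled). -/
def RootColored (M T : Finset V) (r : V) (v : ℤ) : Prop :=
  ∃ X R : Finset V, Disjoint X R ∧ X ∪ R = T ∧ X ⊆ M ∧ Separated G X X ∧ r ∈ X ∧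
    v + 2 * (T ∩ M).card ≤ 3 * X.card + oddCount G R

variable (G) in
/-- Coloring `X ∌ r` when `M ∩ T` is marked in `T` gains at least `v` (doubled), not counting the
part `O` of the root `r`, whose order is congruent to `p` modulo `2`. -/
def RootUncolored (M T : Finset V) (r : V) (p : ℕ) (v : ℤ) : Prop :=
  ∃ X O R : Finset V, Disjoint X O ∧ Disjoint X R ∧ Disjoint O R ∧ X ∪ O ∪ R = T ∧ X ⊆ M ∧
    Separated G X X ∧ r ∈ O ∧ Separated G O R ∧ O.card % 2 = p ∧
    v + 2 * (T ∩ M).card ≤ 3 * X.card + oddCount G R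

section Join

variable {M T₁ T₂ : Finset V} {r s : V} {p q : ℕ} {a b : ℤ}

lemma RootColored.mono {T : Finset V} (h : RootColored G M T r a) (hab : b ≤ a) :
    RootColored G M T r b := by
  obtain ⟨X, R, h1, h2, h3, h4, h5, h6⟩ := h
  exact ⟨X, R, h1, h2, h3, h4, h5, by omega⟩

lemma RootUncolored.mono {T : Finset V} (h : RootUncolored G M T r p a) (hab : b ≤ a) :
    RootUncolored G M T r p b := by
  obtain ⟨X, O, R, h1, h2, h3, h4, h5, h6, h7, h8, h9, h10⟩ := h
  exact ⟨X, O, R, h1, h2, h3, h4, h5, h6, h7, h8, h9, by omega⟩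

lemma card_union_inter (hd : Disjoint T₁ T₂) :
    ((T₁ ∪ T₂) ∩ M).card = (T₁ ∩ M).card + (T₂ ∩ M).card := by
  rw [Finset.union_inter_distrib_right, Finset.card_union_of_disjoint]
  exact hd.mono Finset.inter_subset_left Finset.inter_subset_left

lemma separated_self_union {A B : Finset V} (hA : Separated G A A) (hB : Separated G B B)
    (hAB : Separated G A B) : Separated G (A ∪ B) (A ∪ B) := by
  intro x hx y hy
  rcases Finset.mem_union.1 hx with hx | hx <;> rcases Finset.mem_union.1 hy with hy | hy
  exacts [hA x hx y hy, hAB x hx y hy, hAB.symm x hx y hy, hB x hx y hy]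

lemma RootColored.join_uncolored (hd : Disjoint T₁ T₂)
    (he : ∀ x ∈ T₁, ∀ y ∈ T₂, G.Adj x y → x = r ∧ y = s)
    (h₁ : RootColored G M T₁ r a) (h₂ : RootUncolored G M T₂ s p b) :
    RootColored G M (T₁ ∪ T₂) r (a + b + p) := by
  obtain ⟨X, R, hXR, rfl, hXM, hX, hr, hv⟩ := h₁
  obtain ⟨Y, O, Q, hYO, hYQ, hOQ, rfl, hYM, hY, hs, hsep, hp, hw⟩ := h₂
  have hd' := Finset.disjoint_left.1 hd
  simp only [Finset.mem_union, not_or] at hd' he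
  have hXR' := Finset.disjoint_left.1 hXR
  have hYO' := Finset.disjoint_left.1 hYO
  have hYQ' := Finset.disjoint_left.1 hYQ
  have hOQ' := Finset.disjoint_left.1 hOQ
  have hsepR : Separated G R (O ∪ Q) := fun x hx y hy hxy => by
    have := he x (by grind) y (by grind) hxy
    grind
  have hdR : Disjoint R (O ∪ Q) := by
    rw [Finset.disjoint_left]; grind
  have hO := (oddCount_le_and_mod (G := G) O).2
  refine ⟨X ∪ Y, R ∪ (O ∪ Q), ?_, by grind, Finset.union_subset hXM hYM, ?_, by grind, ?_⟩
  · rw [Finset.disjoint_left]; grind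
  · refine separated_self_union hX hY fun x hx y hy hxy => ?_
    have := he x (by grind) y (by grind) hxy
    grind
  · rw [card_union_inter hd, oddCount_union hdR hsepR, oddCount_union hOQ hsep,
      Finset.card_union_of_disjoint (by rw [Finset.disjoint_left]; grind)]
    push_cast
    omega

lemma RootUncolored.join_colored (hd : Disjoint T₁ T₂)
    (he : ∀ x ∈ T₁, ∀ y ∈ T₂, G.Adj x y → x = r ∧ y = s)
    (h₁ : RootUncolored G M T₁ r p a) (h₂ : RootColored G M T₂ s b) :
    RootUncolored G M (T₁ ∪ T₂) r p (a + b) := by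
  obtain ⟨Y, O, Q, hYO, hYQ, hOQ, rfl, hYM, hY, hs, hsep, hp, hw⟩ := h₁
  obtain ⟨X, R, hXR, rfl, hXM, hX, hr, hv⟩ := h₂
  have hd' := Finset.disjoint_left.1 hd
  simp only [Finset.mem_union, not_or] at hd' he
  have hXR' := Finset.disjoint_left.1 hXR
  have hYO' := Finset.disjoint_left.1 hYO
  have hYQ' := Finset.disjoint_left.1 hYQ
  have hOQ' := Finset.disjoint_left.1 hOQ
  have hsepR : Separated G (O ∪ Q) R := fun x hx y hy hxy => by
    have := he x (by grind) y (by grind) hxy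
    grind
  have hdR : Disjoint Q R := by
    rw [Finset.disjoint_left]; grind
  refine ⟨Y ∪ X, O, Q ∪ R, ?_, ?_, ?_, by grind, Finset.union_subset hYM hXM, ?_, hs, ?_, hp, ?_⟩
  · rw [Finset.disjoint_left]; grind
  · rw [Finset.disjoint_left]; grind
  · rw [Finset.disjoint_left]; grind
  · refine separated_self_union hY hX fun x hx y hy hxy => ?_
    have := he x (by grind) y (by grind) hxy
    grind
  · intro x hx y hy
    rcases Finset.mem_union.1 hy with hy | hy
    · exact hsep x hx y hy
    · exact hsepR x (by grind) y hy
  · rw [card_union_inter hd, oddCount_union hdR fun x hx y hy => hsepR x (by grind) y hy,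
      Finset.card_union_of_disjoint (by rw [Finset.disjoint_left]; grind)]
    push_cast
    omega

lemma RootUncolored.join_uncolored (hd : Disjoint T₁ T₂)
    (he : ∀ x ∈ T₁, ∀ y ∈ T₂, G.Adj x y → x = r ∧ y = s)
    (h₁ : RootUncolored G M T₁ r p a) (h₂ : RootUncolored G M T₂ s q b) :
    RootUncolored G M (T₁ ∪ T₂) r ((p + q) % 2) (a + b) := by
  obtain ⟨Y, O, Q, hYO, hYQ, hOQ, rfl, hYM, hY, hr, hsep, hp, hw⟩ := h₁
  obtain ⟨X, P, R, hXP, hXR, hPR, rfl, hXM, hX, hs, hsep', hq, hv⟩ := h₂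
  have hd' := Finset.disjoint_left.1 hd
  simp only [Finset.mem_union, not_or] at hd' he
  have hXR' := Finset.disjoint_left.1 hXR
  have hXP' := Finset.disjoint_left.1 hXP
  have hPR' := Finset.disjoint_left.1 hPR
  have hYO' := Finset.disjoint_left.1 hYO
  have hYQ' := Finset.disjoint_left.1 hYQ
  have hOQ' := Finset.disjoint_left.1 hOQ
  have hQ : Separated G Q (X ∪ P ∪ R) := fun x hx y hy hxy => by
    have := he x (by grind) y (by grind) hxy
    grind
  have hR : Separated G (Y ∪ O ∪ Q) R := fun x hx y hy hxy => by
    have := he x (by grind) y (by grind) hxy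
    grind
  have hOP : Disjoint O P := by
    rw [Finset.disjoint_left]; grind
  refine ⟨Y ∪ X, O ∪ P, Q ∪ R, ?_, ?_, ?_, by grind, Finset.union_subset hYM hXM, ?_, by grind,
    ?_, ?_, ?_⟩
  · rw [Finset.disjoint_left]; grind
  · rw [Finset.disjoint_left]; grind
  · rw [Finset.disjoint_left]; grind
  · refine separated_self_union hY hX fun x hx y hy hxy => ?_
    have := he x (by grind) y (by grind) hxy
    grind
  · intro x hx y hy
    rcases Finset.mem_union.1 hx with hx | hx <;> rcases Finset.mem_union.1 hy with hy | hy
    · exact hsep x hx y hy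
    · exact hR x (by grind) y hy
    · exact hQ.symm x (by grind) y hy
    · exact hsep' x hx y hy
  · rw [Finset.card_union_of_disjoint hOP]; omega
  · rw [card_union_inter hd, oddCount_union (by rw [Finset.disjoint_left]; grind)
      fun x hx y hy => hR x (by grind) y hy,
      Finset.card_union_of_disjoint (by rw [Finset.disjoint_left]; grind)]
    push_cast
    omega

end Join

variable (G) in
/-- The gains available in `T` with root `r`. When `r` is marked, a loss with `r` colored is
compensated with `r` uncolored, and vice versa. -/
def RootInvariant (M T : Finset V) (r : V) : Prop :=
  (r ∈ M → ∃ x, RootColored G M T r x ∧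
    (RootUncolored G M T r 0 (-x) ∨ RootUncolored G M T r 1 (-x - 1))) ∧
  (r ∉ M → RootUncolored G M T r 0 0 ∨ RootUncolored G M T r 1 0)

lemma rootInvariant_singleton (M : Finset V) (r : V) : RootInvariant G M {r} r := by
  refine ⟨fun hr => ⟨1, ?_, Or.inr ?_⟩, fun hr => Or.inr ?_⟩
  · exact ⟨{r}, ∅, by simp, by simp, by simpa, by simp [Separated], by simp,
      by simp [Finset.singleton_inter_of_mem hr]⟩
  · exact ⟨∅, {r}, ∅, by simp, by simp, by simp, by simp, by simp, by simp [Separated], by simp,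
      by simp [Separated], by simp, by simp [Finset.singleton_inter_of_mem hr]⟩
  · exact ⟨∅, {r}, ∅, by simp, by simp, by simp, by simp, by simp, by simp [Separated], by simp,
      by simp [Separated], by simp, by simp [Finset.singleton_inter_of_notMem hr]⟩

lemma RootInvariant.join {M T₁ T₂ : Finset V} {r s : V} (hd : Disjoint T₁ T₂)
    (he : ∀ x ∈ T₁, ∀ y ∈ T₂, G.Adj x y → x = r ∧ y = s)
    (h₁ : RootInvariant G M T₁ r) (h₂ : RootInvariant G M T₂ s) :
    RootInvariant G M (T₁ ∪ T₂) r := by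
  constructor
  · intro hr
    obtain ⟨x, hx, hx'⟩ := h₁.1 hr
    by_cases hs : s ∈ M
    · obtain ⟨y, hy, hy'⟩ := h₂.1 hs
      refine ⟨x - y, ?_, ?_⟩
      · rcases hy' with hy' | hy'
        · exact (hx.join_uncolored hd he hy').mono (by push_cast; omega)
        · exact (hx.join_uncolored hd he hy').mono (by push_cast; omega)
      · rcases hx' with hx' | hx'
        · exact Or.inl ((hx'.join_colored hd he hy).mono (by omega))
        · exact Or.inr ((hx'.join_colored hd he hy).mono (by omega))
    · rcases h₂.2 hs with hy | hy
      · refine ⟨x, (hx.join_uncolored hd he hy).mono (by simp), ?_⟩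
        rcases hx' with hx' | hx'
        · exact Or.inl ((hx'.join_uncolored hd he hy).mono (by omega))
        · exact Or.inr ((hx'.join_uncolored hd he hy).mono (by omega))
      · refine ⟨x + 1, (hx.join_uncolored hd he hy).mono (by simp), ?_⟩
        rcases hx' with hx' | hx'
        · exact Or.inr ((hx'.join_uncolored hd he hy).mono (by omega))
        · exact Or.inl ((hx'.join_uncolored hd he hy).mono (by omega))
  · intro hr
    have key : RootColored G M T₂ s 0 ∨ RootUncolored G M T₂ s 0 0 ∨
        RootUncolored G M T₂ s 1 0 := by
      by_cases hs : s ∈ M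
      · obtain ⟨y, hy, hy'⟩ := h₂.1 hs
        rcases le_or_gt 0 y with h0 | h0
        · exact Or.inl (hy.mono h0)
        · exact Or.inr (hy'.imp (fun h => h.mono (by omega)) fun h => h.mono (by omega))
      · exact Or.inr (h₂.2 hs)
    rcases h₁.2 hr with h | h <;> rcases key with k | k | k
    · exact Or.inl (h.join_colored hd he k)
    · exact Or.inl (h.join_uncolored hd he k)
    · exact Or.inr (h.join_uncolored hd he k)
    · exact Or.inr (h.join_colored hd he k)
    · exact Or.inr (h.join_uncolored hd he k)
    · exact Or.inl (h.join_uncolored hd he k)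

lemma RootColored.exists_gain {M T : Finset V} {r : V} {a : ℤ} (h : RootColored G M T r a)
    (ha : 0 ≤ a) :
    ∃ X ⊆ T ∩ M, Separated G X X ∧ 2 * (T ∩ M).card ≤ 3 * X.card + oddCount G (T \ X) := by
  obtain ⟨X, R, hXR, rfl, hXM, hX, -, hv⟩ := h
  refine ⟨X, by grind, hX, ?_⟩
  rw [Finset.union_sdiff_cancel_left hXR]
  omega

lemma RootUncolored.exists_gain {M T : Finset V} {r : V} {p : ℕ} {a : ℤ}
    (h : RootUncolored G M T r p a) (ha : 0 ≤ a + p) :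
    ∃ X ⊆ T ∩ M, Separated G X X ∧ 2 * (T ∩ M).card ≤ 3 * X.card + oddCount G (T \ X) := by
  obtain ⟨X, O, R, hXO, hXR, hOR, rfl, hXM, hX, -, hsep, hp, hv⟩ := h
  refine ⟨X, by grind, hX, ?_⟩
  have hO := (oddCount_le_and_mod (G := G) O).2
  rw [Finset.union_assoc, Finset.union_sdiff_cancel_left
    (Finset.disjoint_union_right.2 ⟨hXO, hXR⟩), oddCount_union hOR hsep]
  rw [Finset.union_assoc] at hv
  omega

lemma RootInvariant.exists_gain {M T : Finset V} {r : V} (h : RootInvariant G M T r) :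
    ∃ X ⊆ T ∩ M, Separated G X X ∧ 2 * (T ∩ M).card ≤ 3 * X.card + oddCount G (T \ X) := by
  by_cases hr : r ∈ M
  · obtain ⟨x, hx, hx'⟩ := h.1 hr
    rcases le_or_gt 0 x with h0 | h0
    · exact hx.exists_gain h0
    · rcases hx' with hx' | hx'
      · exact hx'.exists_gain (by push_cast; omega)
      · exact hx'.exists_gain (by push_cast; omega)
  · rcases h.2 hr with h | h
    · exact h.exists_gain (by simp)
    · exact h.exists_gain (by simp)

omit [DecidableEq V] in
lemma isAcyclic_induce_mono {S T : Finset V} (hTS : T ⊆ S)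
    (h : (G.induce (S : Set V)).IsAcyclic) : (G.induce (T : Set V)).IsAcyclic :=
  h.comap (SimpleGraph.induceHomOfLE G (Finset.coe_subset.2 hTS)).toHom
    (SimpleGraph.induceHomOfLE G (Finset.coe_subset.2 hTS)).injective

lemma exists_join {T : Finset V} {r : V} (h : (G.induce (T : Set V)).IsAcyclic) (hr : r ∈ T)
    (hne : T ≠ {r}) :
    ∃ T₁ T₂ s, Disjoint T₁ T₂ ∧ T₁ ∪ T₂ = T ∧ r ∈ T₁ ∧ s ∈ T₂ ∧
      ∀ x ∈ T₁, ∀ y ∈ T₂, G.Adj x y → x = r ∧ y = s := by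
  classical
  by_cases hn : ∃ s ∈ T, G.Adj r s
  · obtain ⟨s, hs, hrs⟩ := hn
    set H := G.induce (T : Set V) with hH
    let r' : (T : Set V) := ⟨r, hr⟩
    let s' : (T : Set V) := ⟨s, hs⟩
    have hadj : H.Adj r' s' := hrs
    have hbridge : ¬ (H \ SimpleGraph.fromEdgeSet {s(r', s')}).Reachable r' s' :=
      SimpleGraph.isBridge_iff.1 (SimpleGraph.isAcyclic_iff_forall_adj_isBridge.1 h hadj)
    let T₂ := T.filter fun y => ∃ hy : y ∈ T,
      (H \ SimpleGraph.fromEdgeSet {s(r', s')}).Reachable s' ⟨y, hy⟩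
    have hsub : T₂ ⊆ T := Finset.filter_subset _ _
    refine ⟨T \ T₂, T₂, s, Finset.sdiff_disjoint, Finset.sdiff_union_of_subset hsub, ?_, ?_, ?_⟩
    · rw [Finset.mem_sdiff]
      refine ⟨hr, fun hr₂ => ?_⟩
      obtain ⟨_, _, hreach⟩ := Finset.mem_filter.1 hr₂
      exact hbridge hreach.symm
    · exact Finset.mem_filter.2 ⟨hs, hs, SimpleGraph.Reachable.refl _⟩
    · intro x hx y hy hxy
      obtain ⟨hxT, hx₂⟩ := Finset.mem_sdiff.1 hx
      obtain ⟨_, hyT, hreach⟩ := Finset.mem_filter.1 hy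
      by_contra hcon
      refine hx₂ (Finset.mem_filter.2 ⟨hxT, hxT, ?_⟩)
      by_cases hsw : x = s ∧ y = r
      · obtain ⟨rfl, rfl⟩ := hsw
        exact SimpleGraph.Reachable.refl _
      · refine hreach.trans (SimpleGraph.Adj.reachable ?_)
        rw [SimpleGraph.sdiff_adj]
        refine ⟨hxy.symm, ?_⟩
        simp only [SimpleGraph.fromEdgeSet_adj, Set.mem_singleton_iff, Sym2.eq_iff, r', s',
          Subtype.mk.injEq]
        tauto
  · push Not at hn
    obtain ⟨s, hs, hsr⟩ : ∃ s ∈ T, s ≠ r := by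
      by_contra! hall
      exact hne (Finset.eq_singleton_iff_unique_mem.2 ⟨hr, hall⟩)
    refine ⟨{r}, T \ {r}, s, Finset.disjoint_sdiff, ?_, by simp, by simp [hs, hsr], ?_⟩
    · exact Finset.union_sdiff_of_subset (by simpa)
    · intro x hx y hy hxy
      rw [Finset.mem_singleton.1 hx] at hxy
      exact absurd hxy (hn y (Finset.mem_sdiff.1 hy).1)

lemma rootInvariant_of_isAcyclic (M : Finset V) {T : Finset V} {r : V}
    (h : (G.induce (T : Set V)).IsAcyclic) (hr : r ∈ T) : RootInvariant G M T r := by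
  induction T using Finset.strongInduction generalizing r with
  | H T ih =>
    by_cases hne : T = {r}
    · rw [hne]
      exact rootInvariant_singleton M r
    · obtain ⟨T₁, T₂, s, hd, rfl, hr₁, hs₂, he⟩ := exists_join h hr hne
      have hd' := Finset.disjoint_left.1 hd
      refine RootInvariant.join hd he (ih T₁ ?_ ?_ hr₁) (ih T₂ ?_ ?_ hs₂)
      · exact Finset.ssubset_iff_subset_ne.2 ⟨Finset.subset_union_left, by grind⟩
      · exact isAcyclic_induce_mono Finset.subset_union_left h
      · exact Finset.ssubset_iff_subset_ne.2 ⟨Finset.subset_union_right, by grind⟩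
      · exact isAcyclic_induce_mono Finset.subset_union_right h

/-- Painter's reply on a forest: the potential `(3 * T.card - oddCount G T) / 2` drops by at least
the number of marked vertices. -/
lemma exists_forest_reply (M : Finset V) {T : Finset V}
    (h : (G.induce (T : Set V)).IsAcyclic) :
    ∃ X ⊆ T ∩ M, Separated G X X ∧
      2 * (T ∩ M).card + oddCount G T ≤ 3 * X.card + oddCount G (T \ X) := by
  induction T using induction_parts (G := G) with
  | hind T hT =>
    rcases T.eq_empty_or_nonempty with rfl | ⟨r, hr⟩
    · exact ⟨∅, by simp [Separated]⟩
    · obtain ⟨X, hXT, hX, hv⟩ := (rootInvariant_of_isAcyclic M h hr).exists_gain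
      refine ⟨X, hXT, hX, ?_⟩
      have h1 := (oddCount_le_and_mod (G := G) (T \ X)).2
      have h2 := Finset.card_sdiff_add_card_eq_card (hXT.trans Finset.inter_subset_left)
      rw [hT.oddCount_eq]
      omega
  | hunion A B hd hs hA hB =>
    obtain ⟨X, hXA, hX, hv⟩ := hA (isAcyclic_induce_mono Finset.subset_union_left h)
    obtain ⟨Y, hYB, hY, hw⟩ := hB (isAcyclic_induce_mono Finset.subset_union_right h)
    have hd' := Finset.disjoint_left.1 hd
    refine ⟨X ∪ Y, by grind, separated_self_union hX hY fun x hx y hy =>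
      hs x (by grind) y (by grind), ?_⟩
    have hsd : (A ∪ B) \ (X ∪ Y) = A \ X ∪ B \ Y := by grind
    rw [hsd, card_union_inter hd, oddCount_union hd hs,
      oddCount_union (hd.mono Finset.sdiff_subset Finset.sdiff_subset)
        fun x hx y hy => hs x (by grind) y (by grind),
      Finset.card_union_of_disjoint (by rw [Finset.disjoint_left]; grind)]
    omega

/-- A nonnegative potential that Painter can always lower by the score of the round bounds the
value of the game. -/
lemma slowAux_le_of_potential (Φ : Finset V → ℝ) (h0 : ∀ S, 0 ≤ Φ S)
    (hΦ : ∀ S M : Finset V, M ⊆ S → M.Nonempty → ∃ X ⊆ M, X.Nonempty ∧ Separated G X X ∧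
      M.card + Φ (S \ X) ≤ Φ S) (n : ℕ) (S : Finset V) : (slowAux G n S : ℝ) ≤ Φ S := by
  induction n generalizing S with
  | zero => simpa [slowAux] using h0 S
  | succ n ih =>
    rw [← Nat.le_floor_iff (h0 S), slowAux, Finset.sup_le_iff]
    intro M hM
    rw [Finset.mem_filter, Finset.mem_powerset] at hM
    obtain ⟨X, hXM, hne, hX, hle⟩ := hΦ S M hM.1 hM.2
    rw [Nat.le_floor_iff (h0 S)]
    refine le_trans ?_ hle
    refine le_trans ?_ (add_le_add_right (ih (S \ X)) _)
    have := Nat.sInf_le (show slowAux G n (S \ X) ∈ {k : ℕ | ∃ X : Finset V, X ⊆ M ∧ X.Nonempty ∧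
      (∀ x ∈ X, ∀ y ∈ X, ¬ G.Adj x y) ∧ k = slowAux G n (S \ X)} from ⟨X, hXM, hne, hX, rfl⟩)
    exact_mod_cast Nat.add_le_add_left this _

lemma card_eq_add_sum {ι : Type*} [Fintype ι] {A : Finset V} {Vs : ι → Finset V}
    (hdisjA : ∀ i, Disjoint A (Vs i)) (hdisj : ∀ i j, i ≠ j → Disjoint (Vs i) (Vs j))
    (hcover : ∀ v : V, v ∈ A ∨ ∃ i, v ∈ Vs i) (S : Finset V) :
    (S.card : ℝ) = (S ∩ A).card + ∑ i, ((S ∩ Vs i).card : ℝ) := by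
  have hS : S = S ∩ A ∪ Finset.univ.biUnion fun i => S ∩ Vs i := by
    ext v
    have := hcover v
    simp only [Finset.mem_union, Finset.mem_inter, Finset.mem_biUnion, Finset.mem_univ, true_and]
    grind
  conv_lhs => rw [hS]
  rw [Finset.card_union_of_disjoint, Finset.card_biUnion]
  · push_cast; rfl
  · exact fun i _ j _ hij =>
      (hdisj i j hij).mono Finset.inter_subset_right Finset.inter_subset_right
  · rw [Finset.disjoint_biUnion_right]
    exact fun i _ => (hdisjA i).mono Finset.inter_subset_right Finset.inter_subset_right

end SlowColoring

open SlowColoring in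
theorem stmt_4 {V : Type*} [Fintype V] [DecidableEq V] (G : SimpleGraph V)
    (t : ℕ) (ht : 1 ≤ t) (A : Finset V) (Vs : Fin (t - 1) → Finset V)
    (hA : ∀ u ∈ A, ∀ v ∈ A, ¬ G.Adj u v)
    (hdisjA : ∀ i, Disjoint A (Vs i))
    (hdisj : ∀ i j, i ≠ j → Disjoint (Vs i) (Vs j))
    (hcover : ∀ v : V, v ∈ A ∨ ∃ i, v ∈ Vs i)
    (hforest : ∀ i, (G.induce (↑(Vs i) : Set V)).IsAcyclic) :
    (slowCost G Finset.univ : ℝ) ≤ ((3 * t - 1) / 2 : ℝ) * Fintype.card V := by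
  set C : ℝ := (3 * t - 1) / 2 with hC
  have ht' : (1 : ℝ) ≤ t := by exact_mod_cast ht
  have hC1 : 1 ≤ C := by rw [hC]; linarith
  have hCt : C = 1 + 3 / 2 * ((t - 1 : ℕ) : ℝ) := by
    rw [hC, Nat.cast_sub ht]; push_cast; ring
  obtain ⟨φ, hφ⟩ : ∃ φ : Finset V → ℝ, ∀ T, φ T = (3 * T.card - oddCount G T) / 3 :=
    ⟨_, fun _ => rfl⟩
  have hφ0 : ∀ T, 0 ≤ φ T := fun T => by
    have h1 : (oddCount G T : ℝ) ≤ T.card := by exact_mod_cast (oddCount_le_and_mod T).1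
    have h2 : (0 : ℝ) ≤ T.card := by positivity
    rw [hφ]; linarith
  have hφ1 : ∀ T, φ T ≤ T.card := fun T => by
    have : (0 : ℝ) ≤ oddCount G T := by positivity
    rw [hφ]; linarith
  obtain ⟨Φ, hΦ⟩ : ∃ Φ : Finset V → ℝ, ∀ S, Φ S = C * ((S ∩ A).card + ∑ i, φ (S ∩ Vs i)) :=
    ⟨_, fun _ => rfl⟩
  refine (slowAux_le_of_potential (G := G) Φ ?_ ?_ _ Finset.univ).trans ?_
  · intro S
    have := Finset.sum_nonneg fun i (_ : i ∈ Finset.univ) => hφ0 (S ∩ Vs i)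
    rw [hΦ]
    positivity
  · intro S M hMS hM
    have hm : (0 : ℝ) < M.card := by exact_mod_cast hM.card_pos
    suffices h : ∃ X ⊆ M, Separated G X X ∧ M.card + Φ (S \ X) ≤ Φ S by
      obtain ⟨X, hXM, hX, hle⟩ := h
      refine ⟨X, hXM, ?_, hX, hle⟩
      rw [Finset.nonempty_iff_ne_empty]
      rintro rfl
      rw [Finset.sdiff_empty] at hle
      linarith
    by_cases ha : (M.card : ℝ) ≤ C * (M ∩ A).card
    · refine ⟨M ∩ A, Finset.inter_subset_left, fun x hx y hy =>
        hA x (Finset.mem_inter.1 hx).2 y (Finset.mem_inter.1 hy).2, ?_⟩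
      have h1 : ∀ i, (S \ (M ∩ A)) ∩ Vs i = S ∩ Vs i := fun i => by
        have := Finset.disjoint_left.1 (hdisjA i)
        grind
      have h2 : ((S \ (M ∩ A)) ∩ A).card + (M ∩ A).card = (S ∩ A).card := by
        have : (S \ (M ∩ A)) ∩ A = (S ∩ A) \ (M ∩ A) := by grind
        rw [this, Finset.card_sdiff_add_card_eq_card (by grind)]
      have h3 : (((S \ (M ∩ A)) ∩ A).card : ℝ) + (M ∩ A).card = (S ∩ A).card := by
        exact_mod_cast h2
      simp only [hΦ, h1]
      rw [← h3]
      linarith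
    · obtain ⟨i, hi⟩ : ∃ i, (M.card : ℝ) ≤ C * (2 / 3 * (M ∩ Vs i).card) := by
        by_contra! hlt
        have hsum : ∑ i, C * (2 / 3 * ((M ∩ Vs i).card : ℝ)) ≤
            ∑ _i : Fin (t - 1), (M.card : ℝ) :=
          Finset.sum_le_sum fun i _ => (hlt i).le
        rw [← Finset.mul_sum, ← Finset.mul_sum, Finset.sum_const, Finset.card_univ,
          Fintype.card_fin, nsmul_eq_mul] at hsum
        have h1 : C * M.card = M.card + 3 / 2 * (((t - 1 : ℕ) : ℝ) * M.card) := by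
          rw [hCt]; ring
        have h2 : C * (M.card : ℝ) =
            C * (M ∩ A).card + C * ∑ i, ((M ∩ Vs i).card : ℝ) := by
          rw [card_eq_add_sum hdisjA hdisj hcover M]; ring
        linarith
      obtain ⟨X, hXM, hX, hv⟩ := exists_forest_reply (G := G) M
        (isAcyclic_induce_mono (T := S ∩ Vs i) Finset.inter_subset_right (hforest i))
      refine ⟨X, by grind, hX, ?_⟩
      have hA' : (S \ X) ∩ A = S ∩ A := by
        have := Finset.disjoint_left.1 (hdisjA i)
        grind
      have hj : ∀ j, j ≠ i → (S \ X) ∩ Vs j = S ∩ Vs j := fun j hji => by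
        have := Finset.disjoint_left.1 (hdisj j i hji)
        grind
      have hi' : (S \ X) ∩ Vs i = (S ∩ Vs i) \ X := by grind
      have hMi : S ∩ Vs i ∩ M = M ∩ Vs i := by grind
      have hXc : ((((S ∩ Vs i) \ X).card : ℝ)) + X.card = (S ∩ Vs i).card := by
        exact_mod_cast Finset.card_sdiff_add_card_eq_card (hXM.trans Finset.inter_subset_left)
      rw [hMi] at hv
      have hv' : 2 * ((M ∩ Vs i).card : ℝ) + oddCount G (S ∩ Vs i) ≤
          3 * X.card + oddCount G ((S ∩ Vs i) \ X) := by exact_mod_cast hv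
      have hdrop : 2 / 3 * ((M ∩ Vs i).card : ℝ) + φ ((S \ X) ∩ Vs i) ≤ φ (S ∩ Vs i) := by
        rw [hi', hφ, hφ]
        linarith
      have hsum : ∑ j, φ ((S \ X) ∩ Vs j) + 2 / 3 * ((M ∩ Vs i).card : ℝ) ≤
          ∑ j, φ (S ∩ Vs j) := by
        rw [← Finset.add_sum_erase _ _ (Finset.mem_univ i),
          ← Finset.add_sum_erase _ (fun j => φ (S ∩ Vs j)) (Finset.mem_univ i),
          Finset.sum_congr rfl fun j hj' => by rw [hj j (Finset.ne_of_mem_erase hj')]]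
        linarith
      rw [hΦ, hΦ, hA']
      have := mul_le_mul_of_nonneg_left hsum (zero_le_one.trans hC1)
      linarith
  · have h1 := card_eq_add_sum hdisjA hdisj hcover Finset.univ
    rw [Finset.card_univ] at h1
    rw [h1]
    rw [hΦ]
    gcongr with i
    exact hφ1 _
end

section
/- Let G be a k-degenerate finite simple graph with n vertices. If k is even, then the sum-color cost satisfies ŝ(G) ≤ ((3k+4)/4)·n; if k is odd, then ŝ(G) ≤ ((3k+3)/4)·n. -/
open Finset

/-- A graph is `k`-degenerate if every nonempty (finite) subgraph has a
vertex of degree at most `k`, equivalently every nonempty finite set `A` of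
vertices contains a vertex with at most `k` neighbors inside `A`. -/
def Degenerate {W : Type*} (G : SimpleGraph W) (k : ℕ) : Prop :=
  ∀ A : Finset W, A.Nonempty → ∃ v ∈ A, ({u : W | u ∈ A ∧ G.Adj v u}).ncard ≤ k

/-- The subgraph of `G` induced by `F` is `d`-degenerate. -/
def DegenerateOn {V : Type*} (G : SimpleGraph V) (F : Finset V) (d : ℕ) : Prop :=
  ∀ A ⊆ F, A.Nonempty → ∃ v ∈ A, {u : V | u ∈ A ∧ G.Adj v u}.ncard ≤ d

theorem DegenerateOn.mono {V : Type*} {G : SimpleGraph V} {F S : Finset V} {d : ℕ}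
    (hF : DegenerateOn G F d) (hS : S ⊆ F) :
    DegenerateOn G S d :=
  fun A hA => hF A (hA.trans hS)

theorem finite_neighbors_in {V : Type*} (G : SimpleGraph V) (A : Finset V) (v : V) :
    {u : V | u ∈ A ∧ G.Adj v u}.Finite :=
  A.finite_toSet.subset fun _ h => h.1

section SlowCost

variable {V : Type*} [DecidableEq V] {G : SimpleGraph V}

theorem slowAux_empty (n : ℕ) : slowAux G n ∅ = 0 := by
  cases n with
  | zero => rfl
  | succ n => simp [slowAux, Finset.filter_singleton]

theorem card_sdiff_lt_of_nonempty {S X : Finset V} (hXS : X ⊆ S) (hX : X.Nonempty) :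
    (S \ X).card < S.card :=
  Finset.card_lt_card (Finset.sdiff_ssubset hXS hX)

theorem slowAux_eq_of_card_le (n m : ℕ) (S : Finset V) (hn : S.card ≤ n) (hm : S.card ≤ m) :
    slowAux G n S = slowAux G m S := by
  induction n generalizing m S with
  | zero =>
    obtain rfl : S = ∅ := by simpa using hn
    rw [slowAux_empty, slowAux_empty]
  | succ n ih =>
    cases m with
    | zero =>
      obtain rfl : S = ∅ := by simpa using hm
      rw [slowAux_empty, slowAux_empty]
    | succ m =>
      simp only [slowAux]
      refine Finset.sup_congr rfl fun M hM => ?_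
      have hMS : M ⊆ S := by simp at hM; exact hM.1
      congr 2
      ext j
      refine exists_congr fun X => and_congr_right fun hXM => and_congr_right fun hX =>
        and_congr_right fun _ => ?_
      have := card_sdiff_lt_of_nonempty (hXM.trans hMS) hX
      rw [ih m (S \ X) (by omega) (by omega)]

theorem slowAux_eq_slowCost {n : ℕ} {S : Finset V} (hn : S.card ≤ n) :
    slowAux G n S = slowCost G S :=
  slowAux_eq_of_card_le n S.card S hn le_rfl

/-- A single round of the game, seen from Painter: if every marked set admits an answer keeping
the total score at most `b`, then the cost is at most `b`. -/
theorem slowCost_le {S : Finset V} {b : ℕ}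
    (h : ∀ M ⊆ S, M.Nonempty → ∃ X ⊆ M, X.Nonempty ∧ (∀ x ∈ X, ∀ y ∈ X, ¬ G.Adj x y) ∧
      M.card + slowCost G (S \ X) ≤ b) : slowCost G S ≤ b := by
  unfold slowCost
  rcases hS : S.card with _ | n
  · exact Nat.zero_le _
  · simp only [slowAux]
    refine Finset.sup_le fun M hM => ?_
    simp only [Finset.mem_filter, Finset.mem_powerset] at hM
    obtain ⟨X, hXM, hX, hind, hb⟩ := h M hM.1 hM.2
    refine (Nat.add_le_add_left (Nat.sInf_le (m := slowAux G n (S \ X)) ?_) _).trans ?_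
    · exact ⟨X, hXM, hX, hind, rfl⟩
    have := card_sdiff_lt_of_nonempty (hXM.trans hM.1) hX
    rwa [slowAux_eq_slowCost (by omega)]

theorem slowCost_le_real {S : Finset V} {b : ℝ} (hb : 0 ≤ b)
    (h : ∀ M ⊆ S, M.Nonempty → ∃ X ⊆ M, X.Nonempty ∧ (∀ x ∈ X, ∀ y ∈ X, ¬ G.Adj x y) ∧
      (M.card + slowCost G (S \ X) : ℝ) ≤ b) : (slowCost G S : ℝ) ≤ b := by
  rw [← Nat.le_floor_iff hb]
  refine slowCost_le fun M hMS hM => ?_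
  obtain ⟨X, hXM, hX, hind, hle⟩ := h M hMS hM
  exact ⟨X, hXM, hX, hind, Nat.le_floor (by push_cast; exact hle)⟩

/-- Painter has an optimal answer to every marked set. -/
theorem exists_card_add_slowCost_le {S M : Finset V} (hMS : M ⊆ S) (hM : M.Nonempty) :
    ∃ X ⊆ M, X.Nonempty ∧ (∀ x ∈ X, ∀ y ∈ X, ¬ G.Adj x y) ∧
      M.card + slowCost G (S \ X) ≤ slowCost G S := by
  rcases hS : S.card with _ | n
  · rw [Finset.card_eq_zero] at hS
    subst hS
    exact absurd (Finset.subset_empty.1 hMS) hM.ne_empty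
  · obtain ⟨v, hv⟩ := hM
    have hne : {j : ℕ | ∃ X : Finset V, X ⊆ M ∧ X.Nonempty ∧
        (∀ x ∈ X, ∀ y ∈ X, ¬ G.Adj x y) ∧ j = slowAux G n (S \ X)}.Nonempty :=
      ⟨_, {v}, Finset.singleton_subset_iff.2 hv, by simp, by simp, rfl⟩
    obtain ⟨X, hXM, hX, hind, hval⟩ := Nat.sInf_mem hne
    refine ⟨X, hXM, hX, hind, ?_⟩
    have := card_sdiff_lt_of_nonempty (hXM.trans hMS) hX
    rw [← slowAux_eq_slowCost (n := n) (by omega), ← hval, slowCost, hS]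
    simp only [slowAux]
    have hmem : M ∈ S.powerset.filter fun M => M.Nonempty :=
      Finset.mem_filter.2 ⟨Finset.mem_powerset.2 hMS, v, hv⟩
    exact Finset.le_sup (f := fun M : Finset V => M.card + sInf {j : ℕ | ∃ X : Finset V, X ⊆ M ∧
      X.Nonempty ∧ (∀ x ∈ X, ∀ y ∈ X, ¬ G.Adj x y) ∧ j = slowAux G n (S \ X)})
      hmem

/-- Painter's strategy on a vertex partition: answer in a part where Lister marked at least the
fraction `w i` of the marked set. -/
theorem slowCost_le_sum_div {ι : Type*} [Fintype ι] [DecidableEq ι] (f : V → ι) (w : ι → ℝ)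
    (hw : ∀ i, 0 < w i) (hsum : ∑ i, w i ≤ 1) (S : Finset V) :
    (slowCost G S : ℝ) ≤ ∑ i, (slowCost G {v ∈ S | f v = i} : ℝ) / w i := by
  induction S using Finset.strongInduction with
  | H S ih =>
    refine slowCost_le_real
      (Finset.sum_nonneg fun i _ => div_nonneg (Nat.cast_nonneg _) (hw i).le) fun M hMS hM => ?_
    have hMpos : (0 : ℝ) < M.card := by exact_mod_cast hM.card_pos
    have hle : ∑ i, (M.card : ℝ) * w i ≤ ∑ i, (({v ∈ M | f v = i} : Finset V).card : ℝ) := by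
      rw [← Finset.mul_sum, ← Nat.cast_sum,
        ← Finset.card_eq_sum_card_fiberwise (f := f) (t := Finset.univ) (by simp)]
      nlinarith
    obtain ⟨i, -, hi⟩ := Finset.exists_le_of_sum_le ⟨f hM.choose, Finset.mem_univ _⟩ hle
    have hMi : ({v ∈ M | f v = i} : Finset V).Nonempty := by
      rw [← Finset.card_pos]
      exact_mod_cast (mul_pos hMpos (hw i)).trans_le hi
    obtain ⟨X, hXM, hX, hind, hcost⟩ := exists_card_add_slowCost_le (G := G)
      (Finset.filter_subset_filter (fun v => f v = i) hMS) hMi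
    have hXM' : X ⊆ M := hXM.trans (Finset.filter_subset _ _)
    refine ⟨X, hXM', hX, hind, ?_⟩
    have hrec := ih (S \ X) (Finset.sdiff_ssubset (hXM'.trans hMS) hX)
    have hpart : ∀ j, j ≠ i → ({v ∈ S \ X | f v = j} : Finset V) = {v ∈ S | f v = j} := by
      intro j hj
      ext v
      have := @hXM v
      simp only [Finset.mem_filter, Finset.mem_sdiff] at this ⊢
      constructor
      · exact fun h => ⟨h.1.1, h.2⟩
      · exact fun h => ⟨⟨h.1, fun hv => hj (h.2.symm.trans (this hv).2)⟩, h.2⟩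
    have hparti : ({v ∈ S \ X | f v = i} : Finset V) = {v ∈ S | f v = i} \ X := by
      ext v
      simp only [Finset.mem_filter, Finset.mem_sdiff]
      tauto
    rw [← Finset.add_sum_erase _ _ (Finset.mem_univ i)] at hrec ⊢
    rw [hparti, Finset.sum_congr rfl fun j hj => by rw [hpart j (Finset.ne_of_mem_erase hj)]]
      at hrec
    have hcost' : (({v ∈ M | f v = i} : Finset V).card : ℝ)
        + slowCost G ({v ∈ S | f v = i} \ X) ≤ slowCost G {v ∈ S | f v = i} := by
      exact_mod_cast hcost
    have hdiv : (M.card : ℝ) + slowCost G ({v ∈ S | f v = i} \ X) / w i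
        ≤ slowCost G {v ∈ S | f v = i} / w i := by
      rw [← le_sub_iff_add_le, ← sub_div, le_div_iff₀ (hw i)]
      linarith
    linarith

/-- The vertices of a `k`-degenerate graph can be partitioned into parts of prescribed degeneracies
`d i` whenever `k < ∑ i, (d i + 1)`. -/
theorem DegenerateOn.exists_partition {ι : Type*} [Fintype ι] [DecidableEq ι] {k : ℕ} (d : ι → ℕ)
    (hk : k < ∑ i, (d i + 1)) {S : Finset V} (hS : DegenerateOn G S k) :
    ∃ f : V → ι, ∀ i, DegenerateOn G {v ∈ S | f v = i} (d i) := by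
  classical
  induction S using Finset.strongInduction with
  | H S ih =>
    have hι : Nonempty ι := by
      by_contra hι
      rw [not_nonempty_iff] at hι
      simp at hk
    rcases S.eq_empty_or_nonempty with rfl | hne
    · refine ⟨fun _ => Classical.arbitrary ι, fun i A hA hAne => ?_⟩
      simp only [Finset.filter_empty, Finset.subset_empty] at hA
      exact absurd hA hAne.ne_empty
    · obtain ⟨v, hv, hdeg⟩ := hS S subset_rfl hne
      obtain ⟨f, hf⟩ := ih (S.erase v) (Finset.erase_ssubset hv)
        (hS.mono (Finset.erase_subset _ _))
      have hset : {u : V | u ∈ S ∧ G.Adj v u} = ({u ∈ S | G.Adj v u} : Finset V) := by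
        ext u; simp
      rw [hset, Set.ncard_coe_finset] at hdeg
      obtain ⟨i, hi⟩ : ∃ i, ({u ∈ {u ∈ S | G.Adj v u} | f u = i} : Finset V).card ≤ d i := by
        by_contra! hcon
        have hsum := Finset.sum_le_sum fun i (_ : i ∈ Finset.univ) => Nat.succ_le_of_lt (hcon i)
        rw [← Finset.card_eq_sum_card_fiberwise (f := f) (t := Finset.univ) (by simp)] at hsum
        simp only [Nat.succ_eq_add_one] at hsum
        omega
      refine ⟨Function.update f v i, fun j A hA hAne => ?_⟩
      by_cases hvA : v ∈ A
      · have hij : i = j := by simpa using (Finset.mem_filter.1 (hA hvA)).2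
        subst hij
        refine ⟨v, hvA, le_trans ?_ hi⟩
        rw [← Set.ncard_coe_finset]
        refine Set.ncard_le_ncard (fun u hu => ?_) (Finset.finite_toSet _)
        obtain ⟨huA, huv⟩ := hu
        have := Finset.mem_filter.1 (hA huA)
        rw [Function.update_of_ne huv.ne'] at this
        simp [this.1, this.2, huv]
      · refine hf j A (fun u hu => ?_) hAne
        have huv : u ≠ v := fun h => hvA (h ▸ hu)
        have := Finset.mem_filter.1 (hA hu)
        rw [Function.update_of_ne huv] at this
        simp [this.1, this.2, huv]

theorem DegenerateOn.slowCost_le_card {S : Finset V} (hS : DegenerateOn G S 0) :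
    slowCost G S ≤ S.card := by
  induction S using Finset.strongInduction with
  | H S ih =>
    refine slowCost_le fun M hMS hM => ⟨M, subset_rfl, hM, fun x hx y hy hxy => ?_, ?_⟩
    · obtain ⟨v, hv, hdeg⟩ := hS {x, y} (by
        intro z hz
        simp only [Finset.mem_insert, Finset.mem_singleton] at hz
        rcases hz with rfl | rfl
        exacts [hMS hx, hMS hy]) (by simp)
      rw [Nat.le_zero, Set.ncard_eq_zero (finite_neighbors_in G _ v)] at hdeg
      simp only [Finset.mem_insert, Finset.mem_singleton] at hv
      rcases hv with rfl | rfl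
      · exact Set.eq_empty_iff_forall_notMem.1 hdeg y ⟨by simp, hxy⟩
      · exact Set.eq_empty_iff_forall_notMem.1 hdeg x ⟨by simp, hxy.symm⟩
    · have := ih (S \ M) (Finset.sdiff_ssubset hMS hM) (hS.mono Finset.sdiff_subset)
      have := Finset.card_sdiff_add_card_eq_card hMS
      omega

/-- Removing an edge of a forest disconnects its endpoints. -/
theorem DegenerateOn.exists_split {S : Finset V} (hS : DegenerateOn G S 1) {a b : V} (ha : a ∈ S)
    (hb : b ∈ S) (hab : G.Adj a b) :
    ∃ S₁ S₂, S₁ ∪ S₂ = S ∧ Disjoint S₁ S₂ ∧ a ∈ S₁ ∧ b ∈ S₂ ∧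
      ∀ x ∈ S₁, ∀ y ∈ S₂, G.Adj x y → x = a ∧ y = b := by
  induction S using Finset.strongInduction with
  | H S ih =>
    obtain ⟨v, hv, hdeg⟩ := hS S subset_rfl ⟨a, ha⟩
    rw [Set.ncard_le_one (finite_neighbors_in G S v)] at hdeg
    have huniq : ∀ x ∈ S, ∀ y ∈ S, G.Adj v x → G.Adj v y → x = y :=
      fun x hx y hy h h' => hdeg x ⟨hx, h⟩ y ⟨hy, h'⟩
    by_cases hva : v = a
    · subst hva
      refine ⟨{v}, S.erase v, ?_, by simp, by simp, by simp [hb, hab.ne'], ?_⟩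
      · rw [← Finset.insert_eq, Finset.insert_erase hv]
      · intro x hx y hy hxy
        obtain rfl := Finset.mem_singleton.1 hx
        exact ⟨rfl, huniq y (Finset.mem_of_mem_erase hy) b hb hxy hab⟩
    by_cases hvb : v = b
    · subst hvb
      refine ⟨S.erase v, {v}, ?_, by simp, by simp [ha, hab.ne], by simp, ?_⟩
      · rw [Finset.union_comm, ← Finset.insert_eq, Finset.insert_erase hv]
      · intro x hx y hy hxy
        obtain rfl := Finset.mem_singleton.1 hy
        exact ⟨huniq x (Finset.mem_of_mem_erase hx) a ha hxy.symm hab.symm, rfl⟩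
    obtain ⟨S₁, S₂, hun, hdis, ha₁, hb₂, hedge⟩ := ih (S.erase v) (Finset.erase_ssubset hv)
      (hS.mono (Finset.erase_subset _ _)) (by simp [ha, Ne.symm hva]) (by simp [hb, Ne.symm hvb])
    have hv₁ : v ∉ S₁ := fun h => by
      have : v ∈ S.erase v := hun ▸ Finset.mem_union_left _ h
      simp at this
    have hv₂ : v ∉ S₂ := fun h => by
      have : v ∈ S.erase v := hun ▸ Finset.mem_union_right _ h
      simp at this
    have hS₁ : ∀ x ∈ S₁, x ∈ S := fun x hx =>
      Finset.mem_of_mem_erase (hun ▸ Finset.mem_union_left _ hx)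
    have hS₂ : ∀ x ∈ S₂, x ∈ S := fun x hx =>
      Finset.mem_of_mem_erase (hun ▸ Finset.mem_union_right _ hx)
    by_cases hnb : ∃ u ∈ S₁, G.Adj v u
    · obtain ⟨u, hu, hvu⟩ := hnb
      refine ⟨insert v S₁, S₂, ?_, ?_, by simp [ha₁], hb₂, ?_⟩
      · rw [Finset.insert_union, hun, Finset.insert_erase hv]
      · rw [Finset.disjoint_insert_left]
        exact ⟨hv₂, hdis⟩
      · intro x hx y hy hxy
        rcases Finset.mem_insert.1 hx with rfl | hx
        · obtain rfl := huniq u (hS₁ u hu) y (hS₂ y hy) hvu hxy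
          exact absurd hy (Finset.disjoint_left.1 hdis hu)
        · exact hedge x hx y hy hxy
    · refine ⟨S₁, insert v S₂, ?_, ?_, ha₁, by simp [hb₂], ?_⟩
      · rw [Finset.union_insert, hun, Finset.insert_erase hv]
      · rw [Finset.disjoint_insert_right]
        exact ⟨hv₁, hdis⟩
      · intro x hx y hy hxy
        rcases Finset.mem_insert.1 hy with rfl | hy
        · exact absurd ⟨x, hx, hxy.symm⟩ hnb
        · exact hedge x hx y hy hxy

/-- `OddPieces G S m` says that `S` has a partition into sets without edges of `G` between them,
exactly `m` of which have odd size. -/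
inductive OddPieces (G : SimpleGraph V) : Finset V → ℕ → Prop
  | single (S : Finset V) : OddPieces G S (S.card % 2)
  | union {S T : Finset V} {m n : ℕ} (hS : OddPieces G S m) (hT : OddPieces G T n)
      (hdis : Disjoint S T) (hadj : ∀ x ∈ S, ∀ y ∈ T, ¬ G.Adj x y) : OddPieces G (S ∪ T) (m + n)

theorem OddPieces.mod_two {S : Finset V} {m : ℕ} (h : OddPieces G S m) : m % 2 = S.card % 2 := by
  induction h with
  | single S => simp
  | union _ _ hdis _ ihS ihT =>
    rw [Finset.card_union_of_disjoint hdis]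
    omega

/-- Painter's option of colouring `X` when `M` is marked, together with the number of odd pieces
that are left. -/
structure IsReply (G : SimpleGraph V) (S M X : Finset V) (m : ℕ) : Prop where
  subset : X ⊆ M
  indep : ∀ x ∈ X, ∀ y ∈ X, ¬ G.Adj x y
  pieces : OddPieces G (S \ X) m

/-- Replies on the two sides of a partition combine unless both use the ends of an edge. -/
theorem IsReply.union {S₁ S₂ M₁ M₂ X₁ X₂ : Finset V} {m₁ m₂ : ℕ} (h₁ : IsReply G S₁ M₁ X₁ m₁)
    (h₂ : IsReply G S₂ M₂ X₂ m₂) (hM₁ : M₁ ⊆ S₁) (hM₂ : M₂ ⊆ S₂) (hdis : Disjoint S₁ S₂)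
    (hX : ∀ x ∈ X₁, ∀ y ∈ X₂, ¬ G.Adj x y)
    (hS : ∀ x ∈ S₁ \ X₁, ∀ y ∈ S₂ \ X₂, ¬ G.Adj x y) :
    IsReply G (S₁ ∪ S₂) (M₁ ∪ M₂) (X₁ ∪ X₂) (m₁ + m₂) ∧
      (X₁ ∪ X₂).card = X₁.card + X₂.card := by
  have hX₁ := h₁.subset.trans hM₁
  have hX₂ := h₂.subset.trans hM₂
  refine ⟨⟨Finset.union_subset_union h₁.subset h₂.subset, ?_, ?_⟩,
    Finset.card_union_of_disjoint (Finset.disjoint_of_subset_left hX₁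
      (Finset.disjoint_of_subset_right hX₂ hdis))⟩
  · intro x hx y hy hxy
    rcases Finset.mem_union.1 hx with hx | hx <;> rcases Finset.mem_union.1 hy with hy | hy
    · exact h₁.indep x hx y hy hxy
    · exact hX x hx y hy hxy
    · exact hX y hy x hx hxy.symm
    · exact h₂.indep x hx y hy hxy
  · have heq : (S₁ ∪ S₂) \ (X₁ ∪ X₂) = S₁ \ X₁ ∪ S₂ \ X₂ := by
      ext v
      have h1 := @hX₁ v
      have h2 := @hX₂ v
      have h3 : v ∈ S₁ → v ∉ S₂ := fun h => Finset.disjoint_left.1 hdis h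
      simp only [Finset.mem_sdiff, Finset.mem_union]
      tauto
    rw [heq]
    exact .union h₁.pieces h₂.pieces (Finset.disjoint_of_subset_left Finset.sdiff_subset
      (Finset.disjoint_of_subset_right Finset.sdiff_subset hdis)) hS

/-- From two replies that are good on average one gets, by parity, a single good reply. -/
theorem exists_reply_of_pair {S M : Finset V} (hMS : M ⊆ S)
    (h : ∀ r ∈ M, ∃ X Y m n, IsReply G S M X m ∧ IsReply G S M Y n ∧ r ∈ X ∧ r ∉ Y ∧
      4 * M.card ≤ 3 * X.card + m + (3 * Y.card + n)) :
    ∃ X m, IsReply G S M X m ∧ 2 * M.card + S.card % 2 ≤ 3 * X.card + m := by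
  rcases M.eq_empty_or_nonempty with rfl | ⟨r, hr⟩
  · exact ⟨∅, S.card % 2, ⟨subset_rfl, by simp, by simpa using .single S⟩, by simp⟩
  · obtain ⟨X, Y, m, n, hX, hY, -, -, hle⟩ := h r hr
    have hm := hX.pieces.mod_two
    have hn := hY.pieces.mod_two
    have hcX := Finset.card_sdiff_add_card_eq_card (hX.subset.trans hMS)
    have hcY := Finset.card_sdiff_add_card_eq_card (hY.subset.trans hMS)
    by_cases hbig : 2 * M.card + S.card % 2 ≤ 3 * X.card + m
    · exact ⟨X, m, hX, hbig⟩
    · exact ⟨Y, n, hY, by omega⟩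

theorem DegenerateOn.exists_reply_pair {S M : Finset V} (hS : DegenerateOn G S 1) (hMS : M ⊆ S)
    {r : V} (hr : r ∈ M) :
    ∃ X Y m n, IsReply G S M X m ∧ IsReply G S M Y n ∧ r ∈ X ∧ r ∉ Y ∧
      4 * M.card ≤ 3 * X.card + m + (3 * Y.card + n) := by
  induction hM : M.card using Nat.strong_induction_on generalizing S M r with
  | _ N ih =>
  subst hM
  by_cases hnb : ∃ c ∈ M, G.Adj r c
  · obtain ⟨c, hc, hrc⟩ := hnb
    obtain ⟨S₁, S₂, rfl, hdis, hr₁, hc₂, hedge⟩ := hS.exists_split (hMS hr) (hMS hc) hrc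
    have hrS₂ : r ∉ S₂ := Finset.disjoint_left.1 hdis hr₁
    have hcS₁ : c ∉ S₁ := Finset.disjoint_right.1 hdis hc₂
    have hlt₁ : (M ∩ S₁).card < M.card := Finset.card_lt_card
      ⟨Finset.inter_subset_left, fun h => hcS₁ (Finset.mem_inter.1 (h hc)).2⟩
    have hlt₂ : (M ∩ S₂).card < M.card := Finset.card_lt_card
      ⟨Finset.inter_subset_left, fun h => hrS₂ (Finset.mem_inter.1 (h hr)).2⟩
    have hMeq : M ∩ S₁ ∪ M ∩ S₂ = M := by
      rw [← Finset.inter_union_distrib_left, Finset.inter_eq_left.2 hMS]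
    have hMcard : (M ∩ S₁).card + (M ∩ S₂).card = M.card := by
      rw [← Finset.card_union_of_disjoint, hMeq]
      exact Finset.disjoint_of_subset_left Finset.inter_subset_right
        (Finset.disjoint_of_subset_right Finset.inter_subset_right hdis)
    obtain ⟨X₁, Y₁, m₁, n₁, hX₁, hY₁, hrX₁, hrY₁, hle₁⟩ := ih _ hlt₁
      (hS.mono Finset.subset_union_left) Finset.inter_subset_right
      (Finset.mem_inter.2 ⟨hr, hr₁⟩) rfl
    obtain ⟨X₂, Y₂, m₂, n₂, hX₂, hY₂, hcX₂, hcY₂, hle₂⟩ := ih _ hlt₂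
      (hS.mono Finset.subset_union_right) Finset.inter_subset_right
      (Finset.mem_inter.2 ⟨hc, hc₂⟩) rfl
    have hsub {M' S' X : Finset V} {m : ℕ} (h : IsReply G S' (M' ∩ S') X m) {v : V} (hv : v ∈ X) :
        v ∈ S' := (Finset.mem_inter.1 (h.subset hv)).2
    obtain ⟨hXY, hcXY⟩ := hX₁.union hY₂ Finset.inter_subset_right Finset.inter_subset_right hdis
      (fun x hx y hy hxy => hcY₂ ((hedge x (hsub hX₁ hx) y (hsub hY₂ hy) hxy).2 ▸ hy))
      (fun x hx y hy hxy => (Finset.mem_sdiff.1 hx).2 ((hedge x (Finset.mem_sdiff.1 hx).1 y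
        (Finset.mem_sdiff.1 hy).1 hxy).1 ▸ hrX₁))
    obtain ⟨hYX, hcYX⟩ := hY₁.union hX₂ Finset.inter_subset_right Finset.inter_subset_right hdis
      (fun x hx y hy hxy => hrY₁ ((hedge x (hsub hY₁ hx) y (hsub hX₂ hy) hxy).1 ▸ hx))
      (fun x hx y hy hxy => (Finset.mem_sdiff.1 hy).2 ((hedge x (Finset.mem_sdiff.1 hx).1 y
        (Finset.mem_sdiff.1 hy).1 hxy).2 ▸ hcX₂))
    rw [hMeq] at hXY hYX
    refine ⟨X₁ ∪ Y₂, Y₁ ∪ X₂, m₁ + n₂, n₁ + m₂, hXY, hYX, Finset.mem_union_left _ hrX₁, ?_, ?_⟩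
    · rw [Finset.mem_union, not_or]
      exact ⟨hrY₁, fun h => hrS₂ (hsub hX₂ h)⟩
    · omega
  · have hlt : (M.erase r).card < M.card := Finset.card_erase_lt_of_mem hr
    have hcM := Finset.card_erase_add_one hr
    have hcS := Finset.card_erase_add_one (hMS hr)
    obtain ⟨X, m, hX, hXle⟩ := exists_reply_of_pair (G := G)
      (Finset.erase_subset_erase r hMS) fun s hs => ih _ hlt
        (hS.mono (Finset.erase_subset r S)) (Finset.erase_subset_erase r hMS) hs rfl
    obtain ⟨Y, n, hY, hYle⟩ := exists_reply_of_pair (G := G)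
      ((Finset.erase_subset r M).trans hMS) fun s hs => ih _ hlt hS
        ((Finset.erase_subset r M).trans hMS) hs rfl
    have hrX : r ∉ X := fun h => by simpa using hX.subset h
    have hXM : X ⊆ M := hX.subset.trans (Finset.erase_subset _ _)
    refine ⟨insert r X, Y, m, n, ⟨Finset.insert_subset hr hXM, ?_, ?_⟩,
      ⟨hY.subset.trans (Finset.erase_subset _ _), hY.indep, hY.pieces⟩,
      Finset.mem_insert_self _ _, fun h => by simpa using hY.subset h, ?_⟩
    · intro x hx y hy hxy
      rw [Finset.mem_insert] at hx hy
      rcases hx with rfl | hx <;> rcases hy with rfl | hy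
      · exact hxy.ne rfl
      · exact hnb ⟨y, hXM hy, hxy⟩
      · exact hnb ⟨x, hXM hx, hxy.symm⟩
      · exact hX.indep x hx y hy hxy
    · rw [Finset.sdiff_insert, ← Finset.erase_sdiff_comm]
      exact hX.pieces
    · rw [Finset.card_insert_of_notMem hrX]
      omega

theorem DegenerateOn.exists_reply {S M : Finset V} {m : ℕ} (hS : DegenerateOn G S 1)
    (hm : OddPieces G S m) (hMS : M ⊆ S) :
    ∃ X n, IsReply G S M X n ∧ 2 * M.card + m ≤ 3 * X.card + n := by
  induction hm generalizing M with
  | single S => exact exists_reply_of_pair hMS fun r hr => hS.exists_reply_pair hMS hr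
  | @union S T _ _ _ _ hdis hadj ihS ihT =>
    obtain ⟨X, a, hX, hXle⟩ := ihS (hS.mono Finset.subset_union_left)
      (Finset.inter_subset_right (s₁ := M))
    obtain ⟨Y, b, hY, hYle⟩ := ihT (hS.mono Finset.subset_union_right)
      (Finset.inter_subset_right (s₁ := M))
    have hMeq : M ∩ S ∪ M ∩ T = M := by
      rw [← Finset.inter_union_distrib_left, Finset.inter_eq_left.2 hMS]
    have hMcard : (M ∩ S).card + (M ∩ T).card = M.card := by
      rw [← Finset.card_union_of_disjoint, hMeq]
      exact Finset.disjoint_of_subset_left Finset.inter_subset_right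
        (Finset.disjoint_of_subset_right Finset.inter_subset_right hdis)
    obtain ⟨hXY, hc⟩ := hX.union hY Finset.inter_subset_right Finset.inter_subset_right hdis
      (fun x hx y hy => hadj x (Finset.mem_inter.1 (hX.subset hx)).2 y
        (Finset.mem_inter.1 (hY.subset hy)).2)
      (fun x hx y hy => hadj x (Finset.mem_sdiff.1 hx).1 y (Finset.mem_sdiff.1 hy).1)
    rw [hMeq] at hXY
    exact ⟨X ∪ Y, a + b, hXY, by omega⟩

theorem OddPieces.le_card {S : Finset V} {m : ℕ} (h : OddPieces G S m) : m ≤ S.card := by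
  induction h with
  | single S => exact Nat.mod_le _ _
  | union _ _ hdis _ ihS ihT =>
    rw [Finset.card_union_of_disjoint hdis]
    omega

theorem DegenerateOn.two_mul_slowCost_add_le {S : Finset V} {m : ℕ} (hS : DegenerateOn G S 1)
    (hm : OddPieces G S m) : 2 * slowCost G S + m ≤ 3 * S.card := by
  induction S using Finset.strongInduction generalizing m with
  | H S ih =>
    have hfin : {n | OddPieces G S n}.Finite :=
      (Set.finite_le_nat S.card).subset fun _ h => h.le_card
    obtain ⟨p, hmp, hp, hmax⟩ := hfin.exists_le_maximal hm
    have hple := OddPieces.le_card hp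
    suffices h : slowCost G S ≤ (3 * S.card - p) / 2 by omega
    refine slowCost_le fun M hMS hM => ?_
    obtain ⟨X, n, hX, hle⟩ := hS.exists_reply hp hMS
    have hne : X.Nonempty := by
      rw [Finset.nonempty_iff_ne_empty]
      rintro rfl
      have hn : OddPieces G S n := by simpa using hX.pieces
      have hnp : n ≤ p := (le_total p n).elim (hmax hn) id
      have := hM.card_pos
      simp only [Finset.card_empty] at hle
      omega
    have hXS := hX.subset.trans hMS
    have hrec := ih (S \ X) (Finset.sdiff_ssubset hXS hne) (hS.mono Finset.sdiff_subset) hX.pieces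
    have hc := Finset.card_sdiff_add_card_eq_card hXS
    exact ⟨X, hX.subset, hne, hX.indep, by omega⟩

/-- If `k < ∑ i, (d i + 1)` with all `d i ≤ 1`, then Painter can hold the average score of a vertex
of a `k`-degenerate graph to `∑ i, (1 + d i / 2)`. -/
theorem DegenerateOn.slowCost_le_sum_mul_card {ι : Type*} [Fintype ι] [DecidableEq ι] {k : ℕ}
    (d : ι → ℕ) (hd : ∀ i, d i ≤ 1) (hk : k < ∑ i, (d i + 1)) {S : Finset V}
    (hS : DegenerateOn G S k) :
    (slowCost G S : ℝ) ≤ (∑ i, (1 + d i / 2 : ℝ)) * S.card := by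
  obtain ⟨f, hf⟩ := hS.exists_partition d hk
  set B : ℝ := ∑ i, (1 + d i / 2 : ℝ) with hB
  have hpos : ∀ i, (0 : ℝ) < 1 + d i / 2 := fun i => by positivity
  have hBpos : ι → 0 < B := fun i => Finset.sum_pos (fun j _ => hpos j) ⟨i, Finset.mem_univ i⟩
  refine (slowCost_le_sum_div f (fun i => (1 + d i / 2) / B)
    (fun i => div_pos (hpos i) (hBpos i)) ?_ S).trans ?_
  · rw [← Finset.sum_div]
    exact div_self_le_one B
  · rw [Finset.card_eq_sum_card_fiberwise (f := f) (t := Finset.univ) (by simp), Nat.cast_sum,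
      Finset.mul_sum]
    refine Finset.sum_le_sum fun i _ => ?_
    have hpart : (slowCost G {v ∈ S | f v = i} : ℝ)
        ≤ (1 + d i / 2) * ({v ∈ S | f v = i} : Finset V).card := by
      have hi := hf i
      rcases Nat.le_one_iff_eq_zero_or_eq_one.1 (hd i) with h | h <;> rw [h] at hi ⊢
      · simpa using hi.slowCost_le_card
      · have h2 : 2 * (slowCost G {v ∈ S | f v = i} : ℝ)
            ≤ 3 * ({v ∈ S | f v = i} : Finset V).card := by
          exact_mod_cast le_of_add_le_left (hi.two_mul_slowCost_add_le (.single _))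
        push_cast
        linarith
    rw [div_div_eq_mul_div, div_le_iff₀ (hpos i)]
    nlinarith [mul_le_mul_of_nonneg_right hpart (hBpos i).le]

end SlowCost

theorem stmt_6 {V : Type*} [Fintype V] [DecidableEq V] (G : SimpleGraph V)
    (k : ℕ) (hdeg : Degenerate G k) :
    (Even k →
      (slowCost G Finset.univ : ℝ) ≤ ((3 * k + 4) / 4 : ℝ) * Fintype.card V) ∧
    (Odd k →
      (slowCost G Finset.univ : ℝ) ≤ ((3 * k + 3) / 4 : ℝ) * Fintype.card V) := by
  have huniv : DegenerateOn G Finset.univ k := fun A _ => hdeg A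
  constructor
  · rintro ⟨t, rfl⟩
    have h := huniv.slowCost_le_sum_mul_card (ι := Option (Fin t)) (fun i => i.elim 0 fun _ => 1)
      (by rintro (_ | _) <;> simp) (by simp; omega)
    simp only [Fintype.sum_option, Option.elim, Finset.sum_const, Finset.card_univ,
      Fintype.card_fin, nsmul_eq_mul] at h
    convert h using 2
    push_cast
    ring
  · rintro ⟨t, rfl⟩
    have h := huniv.slowCost_le_sum_mul_card (ι := Fin (t + 1)) (fun _ => 1)
      (fun _ => le_rfl) (by simp; omega)
    simp only [Finset.sum_const, Finset.card_univ, Fintype.card_fin, nsmul_eq_mul] at h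
    convert h using 2
    push_cast
    ring
end
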